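/- Let β, κ ∈ ℝ² satisfy |κ|² = |β|² and ⟨κ, β⟩ = 0, and define v : ℝ² → ℂ by v(x) := sin(⟨κ, x⟩). Then v(0) = 0 and v satisfies Δv(x) − 2·(Dv(x))(β) + |β|²·v(x) = 0 for all x ∈ ℝ². -/

import Mathlib

open scoped RealInnerProductSpace

/-- The Laplacian of `f : ℝ² → ℂ`: the sum of the second partial derivatives of `f`
along the standard orthonormal basis directions. -/
noncomputable def laplacian (f : EuclideanSpace ℝ (Fin 2) → ℂ)
    (x : EuclideanSpace ℝ (Fin 2)) : ℂ :=
  ∑ i : Fin 2,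
    fderiv ℝ (fun y => fderiv ℝ f y (EuclideanSpace.single i (1 : ℝ))) x
      (EuclideanSpace.single i (1 : ℝ))

/-- Directional derivative of the ridge function `y ↦ g ⟪κ, y⟫`. -/
theorem fderiv_comp_ofReal_inner_apply {E : Type*} [NormedAddCommGroup E]
    [InnerProductSpace ℝ E] {g : ℂ → ℂ} {g' : ℂ} {κ x : E}
    (hg : HasDerivAt g g' ((⟪κ, x⟫ : ℝ) : ℂ)) (w : E) :
    fderiv ℝ (fun y => g ((⟪κ, y⟫ : ℝ) : ℂ)) x w = g' * ((⟪κ, w⟫ : ℝ) : ℂ) := by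
  have h := hg.comp_ofReal.hasFDerivAt.comp x (innerSL ℝ κ).hasFDerivAt
  have h' : HasFDerivAt (fun y => g ((⟪κ, y⟫ : ℝ) : ℂ)) _ x := h
  rw [h'.fderiv]
  simp [mul_comm]

/-- The Laplacian of a plane wave. -/
theorem laplacian_sin_inner (κ x : EuclideanSpace ℝ (Fin 2)) :
    laplacian (fun y => Complex.sin ((⟪κ, y⟫ : ℝ) : ℂ)) x =
      -((‖κ‖ ^ 2 : ℝ) : ℂ) * Complex.sin ((⟪κ, x⟫ : ℝ) : ℂ) := by
  have second_deriv (w : EuclideanSpace ℝ (Fin 2)) :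
      fderiv ℝ (fun y => fderiv ℝ (fun z => Complex.sin ((⟪κ, z⟫ : ℝ) : ℂ)) y w) x w =
        -Complex.sin ((⟪κ, x⟫ : ℝ) : ℂ) * ((⟪κ, w⟫ : ℝ) : ℂ) * ((⟪κ, w⟫ : ℝ) : ℂ) := by
    simp only [fderiv_comp_ofReal_inner_apply (Complex.hasDerivAt_sin _)]
    exact fderiv_comp_ofReal_inner_apply
      ((Complex.hasDerivAt_cos _).mul_const ((⟪κ, w⟫ : ℝ) : ℂ)) w
  simp only [laplacian, second_deriv, Fin.sum_univ_two, EuclideanSpace.inner_single_right,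
    EuclideanSpace.real_norm_sq_eq]
  simp
  ring

/-- If `|κ|² = |β|²` and `κ ⊥ β`, then `v(x) = sin(⟨κ, x⟩)` vanishes at the
origin and solves the band gap equation `Δv − 2 Dv(β) + |β|² v = 0` on `ℝ²`; it is the
non-trivial solution with an infinitesimally dilute resonator at the origin. -/
theorem sine_solves_dilute_resonator_problem
    (β κ : EuclideanSpace ℝ (Fin 2))
    (hnorm : ‖κ‖ ^ 2 = ‖β‖ ^ 2) (hperp : ⟪κ, β⟫ = (0 : ℝ))
    (v : EuclideanSpace ℝ (Fin 2) → ℂ)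
    (hv : ∀ x, v x = Complex.sin (((⟪κ, x⟫ : ℝ) : ℂ))) :
    v 0 = 0 ∧
      ∀ x : EuclideanSpace ℝ (Fin 2),
        laplacian v x - 2 * fderiv ℝ v x β + ((‖β‖ ^ 2 : ℝ) : ℂ) * v x = 0 := by
  obtain rfl : v = fun x => Complex.sin ((⟪κ, x⟫ : ℝ) : ℂ) := funext hv
  refine ⟨by simp, fun x => ?_⟩
  rw [laplacian_sin_inner, fderiv_comp_ofReal_inner_apply (Complex.hasDerivAt_sin _),
    hperp, hnorm]
  simp
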